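/- Let φ be a Schwartz function with 𝓕φ supported in {|ξ| ≤ 1/2}, s ∈ ℝ, 1 ≤ p, r ≤ ∞, and f_n(x) = 2^{-ns}φ(x)sin((17/12)2ⁿx), g_n(x) = 2^{-n/2}φ(x). Then the pair of initial data (ρ_{0,n}, u_{0,n}) = (2ⁿf_n, f_n) and (ρ̃_{0,n}, v_{0,n}) = (2ⁿf_n + g_n, f_n + g_n) satisfy: (i) ‖ρ_{0,n}‖_{B^{s-1}_{p,r}} + ‖ρ̃_{0,n}‖_{B^{s-1}_{p,r}} + ‖u_{0,n}‖_{B^s_{p,r}} + ‖v_{0,n}‖_{B^s_{p,r}} ≤ C uniformly in n; (ii) ‖ρ̃_{0,n} − ρ_{0,n}‖_{B^{s-1}_{p,r}} + ‖v_{0,n} − u_{0,n}‖_{B^s_{p,r}} ≤ C 2^{-n/2}, hence this difference tends to 0 as n → ∞. -/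

import Mathlib

open MeasureTheory Filter FourierTransform Real ENNReal
noncomputable section

variable {V : Type*} [NormedAddCommGroup V] [InnerProductSpace ℝ V]
  [MeasurableSpace V] [BorelSpace V] [FiniteDimensional ℝ V]

/-- An admissible Littlewood–Paley pair `(χ, φ)` of smooth functions valued in `[0,1]`
with `supp χ ⊆ {‖ξ‖ ≤ 4/3}`, `supp φ ⊆ {3/4 ≤ ‖ξ‖ ≤ 8/3}` and
`χ(ξ) + ∑_{j ≥ 0} φ(2⁻ʲξ) = 1`. -/
structure LPPair (V : Type*) [NormedAddCommGroup V] [InnerProductSpace ℝ V] : Type _ where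
  chi : V → ℝ
  phi : V → ℝ
  chi_smooth : ContDiff ℝ (⊤ : ℕ∞) chi
  phi_smooth : ContDiff ℝ (⊤ : ℕ∞) phi
  chi_mem : ∀ ξ, chi ξ ∈ Set.Icc (0:ℝ) 1
  phi_mem : ∀ ξ, phi ξ ∈ Set.Icc (0:ℝ) 1
  chi_supp : ∀ ξ, chi ξ ≠ 0 → ‖ξ‖ ≤ 4/3
  phi_supp : ∀ ξ, phi ξ ≠ 0 → 3/4 ≤ ‖ξ‖ ∧ ‖ξ‖ ≤ 8/3
  partition : ∀ ξ, chi ξ + ∑' j : ℕ, phi ((2:ℝ)^(-(j:ℤ)) • ξ) = 1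

/-- The nonhomogeneous dyadic block `Δ_j` associated to the pair `P`. -/
def LPPair.block (P : LPPair V) (j : ℤ) (u : V → ℂ) : V → ℂ :=
  if j ≤ -2 then 0
  else if j = -1 then 𝓕⁻ (fun ξ => (P.chi ξ : ℂ) * 𝓕 u ξ)
  else 𝓕⁻ (fun ξ => ((P.phi ((2:ℝ)^(-j) • ξ) : ℝ) : ℂ) * 𝓕 u ξ)

/-- The `ℓ^r(ℤ)` norm of a sequence of extended nonnegative reals. -/
def lqNorm (r : ℝ≥0∞) (a : ℤ → ℝ≥0∞) : ℝ≥0∞ :=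
  if r = ∞ then ⨆ j, a j else (∑' j, a j ^ r.toReal) ^ (1 / r.toReal)

/-- The nonhomogeneous Besov norm `‖u‖_{B^s_{p,r}}` built from the pair `P`. -/
def besovNorm (P : LPPair V) (s : ℝ) (p r : ℝ≥0∞) (u : V → ℂ) : ℝ≥0∞ :=
  lqNorm r (fun j => ENNReal.ofReal ((2:ℝ)^((j:ℝ)*s)) * eLpNorm (P.block j u) p volume)

/-- Besov norm of a real-valued function. -/
def besovNormR (P : LPPair V) (s : ℝ) (p r : ℝ≥0∞) (u : V → ℝ) : ℝ≥0∞ :=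
  besovNorm P s p r (fun x => (u x : ℂ))

/-- The complexification of a real-valued function on `ℝ`. -/
def cplx (u : ℝ → ℝ) : ℝ → ℂ := fun x => (u x : ℂ)

/-- The Fourier multiplier operator `(1 - ∂_x²)⁻¹` on the line. -/
def lowOp (u : ℝ → ℂ) : ℝ → ℂ :=
  𝓕⁻ (fun ξ : ℝ => (((1 + (2*π*ξ)^2)⁻¹ : ℝ) : ℂ) * 𝓕 u ξ)

/-- The Fourier multiplier operator `∂_x (1 - ∂_x²)⁻¹` on the line. -/
def dLowOp (u : ℝ → ℂ) : ℝ → ℂ :=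
  𝓕⁻ (fun ξ : ℝ => ((2*π*ξ : ℝ) : ℂ) * Complex.I * (((1 + (2*π*ξ)^2)⁻¹ : ℝ) : ℂ) * 𝓕 u ξ)

end

namespace LPPair

/-- The Fourier symbol of the dyadic block `Δ_j`. -/
noncomputable def symbol (P : LPPair ℝ) (j : ℤ) (ξ : ℝ) : ℝ :=
  if j ≤ -2 then 0 else if j = -1 then P.chi ξ else P.phi ((2:ℝ)^(-j) • ξ)

theorem block_eq_fourierInv_symbol (P : LPPair ℝ) (j : ℤ) (u : ℝ → ℂ) :
    P.block j u = 𝓕⁻ (fun ξ => (P.symbol j ξ : ℂ) * 𝓕 u ξ) := by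
  unfold block symbol
  split_ifs
  · ext x
    simp [Real.fourierInv_eq]
  · rfl
  · rfl

theorem symbol_of_le_neg_two (P : LPPair ℝ) {j : ℤ} (hj : j ≤ -2) (ξ : ℝ) :
    P.symbol j ξ = 0 := by
  simp [symbol, hj]

theorem abs_le_of_symbol_ne_zero (P : LPPair ℝ) {j : ℤ} {ξ : ℝ} (h : P.symbol j ξ ≠ 0) :
    |ξ| ≤ 8 / 3 * (2:ℝ) ^ j := by
  unfold symbol at h
  split_ifs at h with h1 h2
  · exact absurd rfl h
  · subst h2
    have := P.chi_supp ξ h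
    rw [Real.norm_eq_abs] at this
    norm_num
    linarith
  · have := (P.phi_supp _ h).2
    rw [norm_smul, Real.norm_eq_abs, Real.norm_eq_abs, abs_of_pos (by positivity), zpow_neg,
      inv_mul_le_iff₀ (by positivity)] at this
    linarith

theorem le_abs_of_symbol_ne_zero (P : LPPair ℝ) {j : ℤ} (hj : 0 ≤ j) {ξ : ℝ}
    (h : P.symbol j ξ ≠ 0) : 3 / 4 * (2:ℝ) ^ j ≤ |ξ| := by
  unfold symbol at h
  rw [if_neg (by omega), if_neg (by omega)] at h
  have := (P.phi_supp _ h).1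
  rw [norm_smul, Real.norm_eq_abs, Real.norm_eq_abs, abs_of_pos (by positivity), zpow_neg,
    le_inv_mul_iff₀ (by positivity)] at this
  linarith

end LPPair

/-- `f` is twice continuously differentiable and `f`, `f'`, `f''` are bounded by `B`. -/
def C2BoundedBy (B : ℝ) (f : ℝ → ℝ) : Prop :=
  ∃ f' f'' : ℝ → ℝ, (∀ x, HasDerivAt f (f' x) x) ∧ (∀ x, HasDerivAt f' (f'' x) x) ∧
    Continuous f'' ∧ ∀ x, |f x| ≤ B ∧ |f' x| ≤ B ∧ |f'' x| ≤ B

theorem C2BoundedBy.comp_smul {B : ℝ} {f : ℝ → ℝ} (hf : C2BoundedBy B f) {c : ℝ}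
    (hc0 : 0 ≤ c) (hc1 : c ≤ 1) : C2BoundedBy B (fun x => f (c • x)) := by
  obtain ⟨f', f'', h1, h2, hc, hb⟩ := hf
  have hmul (x : ℝ) : HasDerivAt (fun x : ℝ => c • x) c x := by
    simpa using! (hasDerivAt_id x).const_mul c
  refine ⟨fun x => f' (c • x) * c, fun x => f'' (c • x) * c * c, fun x => ?_, fun x => ?_,
    by fun_prop, fun x => ⟨(hb _).1, ?_, ?_⟩⟩
  · exact (h1 (c • x)).comp x (hmul x)
  · exact ((h2 (c • x)).comp x (hmul x)).mul_const c
  · rw [abs_mul, abs_of_nonneg hc0]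
    exact (mul_le_of_le_one_right (abs_nonneg _) hc1).trans (hb _).2.1
  · rw [abs_mul, abs_mul, abs_of_nonneg hc0]
    exact (mul_le_of_le_one_right (by positivity) hc1).trans
      ((mul_le_of_le_one_right (abs_nonneg _) hc1).trans (hb _).2.2)

theorem C2BoundedBy.mono {B B' : ℝ} {f : ℝ → ℝ} (hf : C2BoundedBy B f) (h : B ≤ B') :
    C2BoundedBy B' f := by
  obtain ⟨f', f'', h1, h2, hc, hb⟩ := hf
  exact ⟨f', f'', h1, h2, hc, fun x =>
    ⟨(hb x).1.trans h, (hb x).2.1.trans h, (hb x).2.2.trans h⟩⟩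

theorem exists_c2BoundedBy {f : ℝ → ℝ} (hf : ContDiff ℝ (⊤ : ℕ∞) f) (hs : HasCompactSupport f) :
    ∃ B, C2BoundedBy B f := by
  have hd : ContDiff ℝ (⊤ : ℕ∞) (deriv f) := (contDiff_infty_iff_deriv.1 hf).2
  have hdd : ContDiff ℝ (⊤ : ℕ∞) (deriv (deriv f)) := (contDiff_infty_iff_deriv.1 hd).2
  obtain ⟨B0, h0⟩ := hs.exists_bound_of_continuous hf.continuous
  obtain ⟨B1, h1⟩ := hs.deriv.exists_bound_of_continuous hd.continuous
  obtain ⟨B2, h2⟩ := hs.deriv.deriv.exists_bound_of_continuous hdd.continuous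
  refine ⟨max B0 (max B1 B2), deriv f, deriv (deriv f), fun x => ?_, fun x => ?_,
    hdd.continuous, fun x => ⟨(h0 x).trans (by simp), (h1 x).trans (by simp),
      (h2 x).trans (by simp)⟩⟩
  · exact ((hf.differentiable (by simp)) x).hasDerivAt
  · exact ((hd.differentiable (by simp)) x).hasDerivAt

theorem LPPair.exists_c2BoundedBy_symbol (P : LPPair ℝ) :
    ∃ B, 0 ≤ B ∧ ∀ j, C2BoundedBy B (P.symbol j) := by
  have hcs {f : ℝ → ℝ} {R : ℝ} (h : ∀ ξ, f ξ ≠ 0 → ‖ξ‖ ≤ R) : HasCompactSupport f :=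
    HasCompactSupport.of_support_subset_isCompact (isCompact_closedBall (0 : ℝ) R)
      fun ξ hξ => by simpa using h ξ hξ
  obtain ⟨B0, h0⟩ := exists_c2BoundedBy P.chi_smooth (hcs P.chi_supp)
  obtain ⟨B1, h1⟩ := exists_c2BoundedBy P.phi_smooth (hcs fun ξ h => (P.phi_supp ξ h).2)
  refine ⟨max 0 (max B0 B1), by simp, fun j => ?_⟩
  by_cases hj : j ≤ -2
  · have : P.symbol j = fun _ => 0 := funext fun ξ => P.symbol_of_le_neg_two hj ξ
    rw [this]
    exact ⟨fun _ => 0, fun _ => 0, fun x => hasDerivAt_const _ _, fun x => hasDerivAt_const _ _,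
      continuous_const, fun x => by simp⟩
  by_cases hj' : j = -1
  · have : P.symbol j = P.chi := funext fun ξ => by simp [symbol, hj']
    rw [this]
    exact h0.mono (by simp)
  · have : P.symbol j = fun ξ => P.phi ((2:ℝ)^(-j) • ξ) :=
      funext fun ξ => by simp only [symbol, hj, hj', if_false]
    rw [this]
    exact (h1.mono (by simp)).comp_smul (by positivity)
      (zpow_le_one_of_nonpos₀ (by norm_num) (by omega))

/-- Two derivatives in frequency give quadratic decay in space. -/
theorem norm_fourierInv_le_of_hasDerivAt {F F' F'' : ℝ → ℂ} (h1 : ∀ x, HasDerivAt F (F' x) x)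
    (h2 : ∀ x, HasDerivAt F' (F'' x) x) (hF : Integrable F) (hF' : Integrable F')
    (hF'' : Integrable F'') (x : ℝ) :
    ‖𝓕⁻ F x‖ ≤ ((∫ ξ, ‖F ξ‖) + ∫ ξ, ‖F'' ξ‖) * (1 + x ^ 2)⁻¹ := by
  have e1 : deriv F = F' := funext fun x => (h1 x).deriv
  have e2 : deriv F' = F'' := funext fun x => (h2 x).deriv
  have k1 := Real.fourier_deriv hF (fun x => (h1 x).differentiableAt) (e1 ▸ hF')
  have k2 := Real.fourier_deriv hF' (fun x => (h2 x).differentiableAt) (e2 ▸ hF'')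
  rw [e1] at k1
  rw [e2] at k2
  have hb (G : ℝ → ℂ) (y : ℝ) : ‖𝓕 G y‖ ≤ ∫ ξ, ‖G ξ‖ :=
    VectorFourier.norm_fourierIntegral_le_integral_norm _ _ _ _ _
  have b0 := hb F (-x)
  have b2 := hb F'' (-x)
  rw [k2, k1] at b2
  simp only [norm_smul, norm_mul] at b2
  rw [← div_eq_mul_inv, le_div_iff₀ (by positivity), Real.fourierInv_eq_fourier_neg]
  have hpi : 1 ≤ 2 * π := by linarith [Real.pi_gt_three]
  have : x ^ 2 * ‖𝓕 F (-x)‖ ≤ ∫ ξ, ‖F'' ξ‖ := by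
    refine le_trans ?_ b2
    simp only [Complex.norm_I, Complex.norm_real, Complex.norm_ofNat, Real.norm_eq_abs, abs_neg,
      abs_of_pos Real.pi_pos, mul_one]
    calc x ^ 2 * ‖𝓕 F (-x)‖ = (1 * |x|) * ((1 * |x|) * ‖𝓕 F (-x)‖) := by
          rw [← sq_abs]; ring
      _ ≤ _ := by gcongr
  linarith

/-- Decay of a frequency-shifted Schwartz function after a multiplier with `C²` bounded symbol;
the constant does not depend on the shift. -/
theorem exists_norm_fourierInv_mul_shift_le (h : SchwartzMap ℝ ℂ) {B : ℝ} (hB : 0 ≤ B) :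
    ∃ D, 0 ≤ D ∧ ∀ m, C2BoundedBy B m → ∀ a x : ℝ,
      Integrable (fun ξ => (m ξ : ℂ) * h (ξ - a)) ∧
      ‖𝓕⁻ (fun ξ => (m ξ : ℂ) * h (ξ - a)) x‖ ≤ D * (1 + x ^ 2)⁻¹ := by
  set h' := SchwartzMap.derivCLM ℝ ℂ h
  set h'' := SchwartzMap.derivCLM ℝ ℂ h'
  have d1 (x : ℝ) : HasDerivAt h (h' x) x := h.differentiableAt.hasDerivAt
  have d2 (x : ℝ) : HasDerivAt h' (h'' x) x := h'.differentiableAt.hasDerivAt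
  let W : ℝ → ℝ := fun ξ => 2 * B * (‖h ξ‖ + ‖h' ξ‖ + ‖h'' ξ‖)
  have hW : Integrable W :=
    ((h.integrable.norm.add h'.integrable.norm).add h''.integrable.norm).const_mul _
  have hW0 (ξ : ℝ) : 0 ≤ W ξ := by positivity
  refine ⟨2 * ∫ ξ, W ξ, mul_nonneg zero_le_two (integral_nonneg hW0), ?_⟩
  rintro m ⟨m', m'', e1, e2, hc, hb⟩ a x
  have hWa : Integrable (fun ξ => W (ξ - a)) := hW.comp_sub_right a
  have c0 : Continuous m := continuous_iff_continuousAt.2 fun x => (e1 x).continuousAt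
  have c1 : Continuous m' := continuous_iff_continuousAt.2 fun x => (e2 x).continuousAt
  have ch := h.continuous
  have ch' := h'.continuous
  have ch'' := h''.continuous
  have s1 (ξ : ℝ) : HasDerivAt (fun ξ => h (ξ - a)) (h' (ξ - a)) ξ := (d1 _).comp_sub_const ξ a
  have s2 (ξ : ℝ) : HasDerivAt (fun ξ => h' (ξ - a)) (h'' (ξ - a)) ξ := (d2 _).comp_sub_const ξ a
  have D1 (ξ : ℝ) : HasDerivAt (fun ξ => (m ξ : ℂ) * h (ξ - a))
      ((m' ξ : ℂ) * h (ξ - a) + m ξ * h' (ξ - a)) ξ := (e1 ξ).ofReal_comp.mul (s1 ξ)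
  have D2 (ξ : ℝ) : HasDerivAt (fun ξ => (m' ξ : ℂ) * h (ξ - a) + m ξ * h' (ξ - a))
      (((m'' ξ : ℂ) * h (ξ - a) + m' ξ * h' (ξ - a)) +
        (m' ξ * h' (ξ - a) + m ξ * h'' (ξ - a))) ξ :=
    ((e2 ξ).ofReal_comp.mul (s1 ξ)).add ((e1 ξ).ofReal_comp.mul (s2 ξ))
  have hm {y : ℝ} (hy : |y| ≤ B) (z : ℂ) : ‖(y : ℂ) * z‖ ≤ B * ‖z‖ := by
    rw [norm_mul, Complex.norm_real, Real.norm_eq_abs]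
    gcongr
  have hBn (z : ℂ) : 0 ≤ B * ‖z‖ := by positivity
  have b0 (ξ : ℝ) : ‖(m ξ : ℂ) * h (ξ - a)‖ ≤ W (ξ - a) := by
    have := hm (hb ξ).1 (h (ξ - a))
    simp only [W]
    linarith [hBn (h (ξ - a)), hBn (h' (ξ - a)), hBn (h'' (ξ - a))]
  have b1 (ξ : ℝ) : ‖(m' ξ : ℂ) * h (ξ - a) + m ξ * h' (ξ - a)‖ ≤ W (ξ - a) := by
    have := hm (hb ξ).2.1 (h (ξ - a))
    have := hm (hb ξ).1 (h' (ξ - a))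
    refine (norm_add_le _ _).trans ?_
    simp only [W]
    linarith [hBn (h (ξ - a)), hBn (h' (ξ - a)), hBn (h'' (ξ - a))]
  have b2 (ξ : ℝ) : ‖((m'' ξ : ℂ) * h (ξ - a) + m' ξ * h' (ξ - a)) +
        (m' ξ * h' (ξ - a) + m ξ * h'' (ξ - a))‖ ≤ W (ξ - a) := by
    have := hm (hb ξ).2.2 (h (ξ - a))
    have := hm (hb ξ).2.1 (h' (ξ - a))
    have := hm (hb ξ).1 (h'' (ξ - a))
    refine (norm_add_le_of_le (norm_add_le _ _) (norm_add_le _ _)).trans ?_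
    simp only [W]
    linarith [hBn (h (ξ - a)), hBn (h' (ξ - a)), hBn (h'' (ξ - a))]
  have i0 : Integrable (fun ξ => (m ξ : ℂ) * h (ξ - a)) :=
    hWa.mono' (by fun_prop) (.of_forall b0)
  have i1 : Integrable (fun ξ => (m' ξ : ℂ) * h (ξ - a) + m ξ * h' (ξ - a)) :=
    hWa.mono' (by fun_prop) (.of_forall b1)
  have i2 : Integrable (fun ξ => ((m'' ξ : ℂ) * h (ξ - a) + m' ξ * h' (ξ - a)) +
        (m' ξ * h' (ξ - a) + m ξ * h'' (ξ - a))) :=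
    hWa.mono' (by fun_prop) (.of_forall b2)
  refine ⟨i0, (norm_fourierInv_le_of_hasDerivAt D1 D2 i0 i1 i2 x).trans ?_⟩
  have j0 := integral_mono i0.norm hWa b0
  have j2 := integral_mono i2.norm hWa b2
  rw [integral_sub_right_eq_self W a] at j0 j2
  gcongr
  linarith

theorem memLp_inv_one_add_sq {p : ℝ≥0∞} (hp : 1 ≤ p) :
    MemLp (fun x : ℝ => (1 + x ^ 2)⁻¹) p := by
  have hm : AEStronglyMeasurable (fun x : ℝ => (1 + x ^ 2)⁻¹) :=
    integrable_inv_one_add_sq.aestronglyMeasurable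
  have h1 (x : ℝ) : (1 + x ^ 2)⁻¹ ≤ 1 := inv_le_one_of_one_le₀ (by nlinarith [sq_nonneg x])
  rcases eq_or_ne p ∞ with rfl | hp'
  · refine memLp_top_of_bound hm 1 (.of_forall fun x => ?_)
    rw [Real.norm_of_nonneg (by positivity)]
    exact h1 x
  · rw [← integrable_norm_rpow_iff hm (by positivity) hp']
    refine integrable_inv_one_add_sq.mono'
      (hm.norm.aemeasurable.pow_const _).aestronglyMeasurable (.of_forall fun x => ?_)
    have hx : 0 < (1 + x ^ 2)⁻¹ := by positivity
    rw [Real.norm_of_nonneg (by positivity), Real.norm_of_nonneg hx.le]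
    exact Real.rpow_le_self_of_le_one hx.le (h1 x) (by
      simpa using ENNReal.toReal_mono hp' hp)

theorem lqNorm_le_tsum {r : ℝ≥0∞} (hr : 1 ≤ r) (a : ℤ → ℝ≥0∞) : lqNorm r a ≤ ∑' j, a j := by
  unfold lqNorm
  split_ifs with h
  · exact iSup_le fun j => ENNReal.le_tsum j
  have hr1 : 1 ≤ r.toReal := by simpa using ENNReal.toReal_mono h hr
  have hsplit (x : ℝ≥0∞) : x ^ r.toReal = x * x ^ (r.toReal - 1) := by
    conv_rhs => rw [← ENNReal.rpow_one x, ← ENNReal.rpow_mul, one_mul,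
      ← ENNReal.rpow_add_of_nonneg _ _ zero_le_one (by linarith)]
    congr 1
    ring
  rw [one_div, ENNReal.rpow_inv_le_iff (by linarith), hsplit (∑' j, a j), ← ENNReal.tsum_mul_right]
  refine ENNReal.tsum_le_tsum fun j => ?_
  rw [hsplit]
  gcongr
  exact ENNReal.le_tsum j

theorem integral_const_mul_sub_add {f₁ f₂ f₃ : ℝ → ℂ} (h₁ : Integrable f₁)
    (h₂ : Integrable f₂) (h₃ : Integrable f₃) (c₁ c₂ c₃ : ℂ) :
    ∫ x, (c₁ * f₁ x - c₂ * f₂ x + c₃ * f₃ x) =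
      c₁ * (∫ x, f₁ x) - c₂ * (∫ x, f₂ x) + c₃ * ∫ x, f₃ x := by
  have h₁₂ : Integrable (fun x => c₁ * f₁ x - c₂ * f₂ x) := (h₁.const_mul c₁).sub (h₂.const_mul c₂)
  rw [integral_add h₁₂ (h₃.const_mul c₃), integral_sub (h₁.const_mul c₁) (h₂.const_mul c₂),
    integral_const_mul, integral_const_mul, integral_const_mul]

theorem fourier_mul_sin_add (ψ : SchwartzMap ℝ ℂ) (A B a ξ : ℝ) :
    𝓕 (fun x : ℝ => (A : ℂ) * (ψ x * Real.sin (2 * π * a * x)) + B * ψ x) ξ =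
      A / (2 * Complex.I) * 𝓕 ψ (ξ - a) - A / (2 * Complex.I) * 𝓕 ψ (ξ - -a) +
        B * 𝓕 ψ (ξ - 0) := by
  have hint (w : ℝ) :
      Integrable (fun x : ℝ => Complex.exp (↑(-2 * π * x * w) * Complex.I) * ψ x) := by
    refine ψ.integrable.bdd_mul (c := 1) (by fun_prop) (.of_forall fun x => ?_)
    rw [Complex.norm_exp_ofReal_mul_I]
  simp only [SchwartzMap.fourier_coe, Real.fourier_real_eq_integral_exp_smul, smul_eq_mul]
  rw [← integral_const_mul_sub_add (hint _) (hint _) (hint _)]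
  congr 1
  ext x
  have e1 : Complex.exp (↑(-2 * π * x * (ξ - a)) * Complex.I) =
      Complex.exp (↑(-2 * π * x * ξ) * Complex.I) * Complex.exp (↑(2 * π * a * x) * Complex.I) := by
    rw [← Complex.exp_add]
    congr 1
    push_cast
    ring
  have e2 : Complex.exp (↑(-2 * π * x * (ξ - -a)) * Complex.I) =
      Complex.exp (↑(-2 * π * x * ξ) * Complex.I) *
        Complex.exp (-↑(2 * π * a * x) * Complex.I) := by
    rw [← Complex.exp_add]
    congr 1
    push_cast
    ring
  rw [e1, e2, sub_zero, Complex.ofReal_sin, Complex.sin]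
  field_simp
  ring_nf
  simp only [Complex.I_sq]
  ring

theorem fourierInv_const_mul_sub_add {f₁ f₂ f₃ : ℝ → ℂ} (h₁ : Integrable f₁)
    (h₂ : Integrable f₂) (h₃ : Integrable f₃) (c₁ c₂ c₃ : ℂ) (x : ℝ) :
    𝓕⁻ (fun ξ => c₁ * f₁ ξ - c₂ * f₂ ξ + c₃ * f₃ ξ) x =
      c₁ * 𝓕⁻ f₁ x - c₂ * 𝓕⁻ f₂ x + c₃ * 𝓕⁻ f₃ x := by
  have hint {f : ℝ → ℂ} (hf : Integrable f) :
      Integrable (fun v : ℝ => Complex.exp (↑(-2 * π * v * -x) * Complex.I) * f v) := by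
    refine hf.bdd_mul (c := 1) (by fun_prop) (.of_forall fun v => ?_)
    rw [Complex.norm_exp_ofReal_mul_I]
  simp only [Real.fourierInv_eq_fourier_neg, Real.fourier_real_eq_integral_exp_smul, smul_eq_mul]
  rw [← integral_const_mul_sub_add (hint h₁) (hint h₂) (hint h₃)]
  congr 1
  ext v
  ring

/-- The dyadic blocks of a low-frequency profile modulated at frequency about `2ⁿ`: the modulated
part only meets the blocks `n - 4 ≤ j ≤ n`, the unmodulated part only the block `j = -1`. -/
theorem LPPair.exists_norm_block_le (P : LPPair ℝ) (ψ : SchwartzMap ℝ ℂ)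
    (hψ : ∀ ξ : ℝ, 𝓕 ψ ξ ≠ 0 → |ξ| ≤ 1 / 2) :
    ∃ D, 0 ≤ D ∧ ∀ (n : ℕ) (A B : ℝ) (j : ℤ) (x : ℝ),
      ‖P.block j (fun x : ℝ => (A : ℂ) * (ψ x * Real.sin (17 / 12 * 2 ^ n * x)) + B * ψ x) x‖ ≤
        ((if j ∈ Finset.Icc (n - 4 : ℤ) n then |A| else 0) + if j = -1 then |B| else 0) *
          (D * (1 + x ^ 2)⁻¹) := by
  obtain ⟨M, hM, hPM⟩ := P.exists_c2BoundedBy_symbol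
  obtain ⟨D, hD, hbd⟩ := exists_norm_fourierInv_mul_shift_le (𝓕 ψ) hM
  refine ⟨D, hD, fun n A B j x => ?_⟩
  set a : ℝ := 17 / 12 * 2 ^ n / (2 * π) with ha
  have haπ : 17 / 12 * 2 ^ n = 2 * π * a := by
    rw [ha]
    field_simp
  have h2n : (1 : ℝ) ≤ 2 ^ n := one_le_pow₀ one_le_two
  have ha_le : a ≤ 2 ^ n / 4 := by
    rw [ha, div_le_iff₀ (by positivity)]
    nlinarith [Real.pi_gt_three]
  have ha_ge : 2 ^ n / 5 ≤ a := by
    rw [ha, le_div_iff₀ (by positivity)]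
    nlinarith [Real.pi_lt_d2]
  have ha0 : 0 ≤ a := by positivity
  have hpt (b : ℝ) := (hbd _ (hPM j) b x).2
  have hint (b : ℝ) := (hbd _ (hPM j) b x).1
  have hvanish {b : ℝ} (h : ∀ ξ, P.symbol j ξ ≠ 0 → |ξ - b| ≤ 1 / 2 → False) :
      𝓕⁻ (fun ξ => (P.symbol j ξ : ℂ) * 𝓕 ψ (ξ - b)) x = 0 := by
    have : (fun ξ => (P.symbol j ξ : ℂ) * 𝓕 ψ (ξ - b)) = fun _ => 0 := by
      ext ξ
      by_contra hne
      rw [mul_eq_zero, not_or, Complex.ofReal_eq_zero] at hne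
      exact h ξ hne.1 (hψ _ hne.2)
    rw [this]
    simp [Real.fourierInv_eq]
  have hmod {b : ℝ} (hb : |b| = a) : ‖𝓕⁻ (fun ξ => (P.symbol j ξ : ℂ) * 𝓕 ψ (ξ - b)) x‖ ≤
      if j ∈ Finset.Icc (n - 4 : ℤ) n then D * (1 + x ^ 2)⁻¹ else 0 := by
    split_ifs with hj
    · exact hpt b
    · rw [hvanish, norm_zero]
      intro ξ hs hξ
      apply hj
      have hj1 : -1 ≤ j := by
        by_contra hlt
        exact hs (P.symbol_of_le_neg_two (by omega) ξ)
      have hub : |ξ| ≤ a + 1 / 2 := by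
        have := abs_sub_abs_le_abs_sub ξ b
        linarith
      have hlb : a - 1 / 2 ≤ |ξ| := by
        have := abs_sub_abs_le_abs_sub b ξ
        rw [abs_sub_comm] at this
        linarith
      have hhalf : (1 / 2 : ℝ) ≤ 2 ^ j := by
        calc (1 / 2 : ℝ) = 2 ^ (-1 : ℤ) := by norm_num
          _ ≤ 2 ^ j := zpow_le_zpow_right₀ one_le_two hj1
      rw [Finset.mem_Icc]
      constructor
      · have hup := P.abs_le_of_symbol_ne_zero hs
        have : (2:ℝ) ^ (n : ℤ) < 2 ^ (j + 5) := by
          rw [zpow_add₀ two_ne_zero, zpow_natCast]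
          norm_num
          linarith
        have := (zpow_lt_zpow_iff_right₀ _root_.one_lt_two).1 this
        omega
      · rcases lt_or_ge j 0 with h0 | h0
        · omega
        · have hlow := P.le_abs_of_symbol_ne_zero h0 hs
          have : (2:ℝ) ^ j ≤ 2 ^ (n : ℤ) := by
            rw [zpow_natCast]
            linarith
          exact (zpow_le_zpow_iff_right₀ _root_.one_lt_two).1 this
  have hlow : ‖𝓕⁻ (fun ξ => (P.symbol j ξ : ℂ) * 𝓕 ψ (ξ - 0)) x‖ ≤
      if j = -1 then D * (1 + x ^ 2)⁻¹ else 0 := by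
    split_ifs with hj
    · exact hpt 0
    · rw [hvanish, norm_zero]
      intro ξ hs hξ
      rw [sub_zero] at hξ
      rcases lt_or_ge j 0 with h0 | h0
      · exact hs (P.symbol_of_le_neg_two (by omega) ξ)
      · have := P.le_abs_of_symbol_ne_zero h0 hs
        have : (1 : ℝ) ≤ 2 ^ j := one_le_zpow₀ one_le_two h0
        linarith
  have hA : ‖(A : ℂ) / (2 * Complex.I)‖ = |A| / 2 := by simp
  have hrw : (fun ξ => (P.symbol j ξ : ℂ) * 𝓕 (fun x : ℝ =>
        (A : ℂ) * (ψ x * Real.sin (2 * π * a * x)) + B * ψ x) ξ) = fun ξ =>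
      A / (2 * Complex.I) * (P.symbol j ξ * 𝓕 ψ (ξ - a)) -
        A / (2 * Complex.I) * (P.symbol j ξ * 𝓕 ψ (ξ - -a)) +
        B * (P.symbol j ξ * 𝓕 ψ (ξ - 0)) := by
    ext ξ
    rw [fourier_mul_sin_add]
    ring
  rw [haπ, P.block_eq_fourierInv_symbol, hrw,
    fourierInv_const_mul_sub_add (hint _) (hint _) (hint _)]
  refine (norm_add_le_of_le (norm_sub_le _ _) le_rfl).trans ?_
  rw [norm_mul, norm_mul, norm_mul, hA, Complex.norm_real, Real.norm_eq_abs]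
  have k1 := mul_le_mul_of_nonneg_left (hmod (abs_of_nonneg ha0)) (by positivity : 0 ≤ |A| / 2)
  have k2 := mul_le_mul_of_nonneg_left (hmod ((abs_neg a).trans (abs_of_nonneg ha0)))
    (by positivity : 0 ≤ |A| / 2)
  have k3 := mul_le_mul_of_nonneg_left hlow (abs_nonneg B)
  refine (add_le_add (add_le_add k1 k2) k3).trans (le_of_eq ?_)
  split_ifs <;> ring

theorem LPPair.exists_besovNormR_le (P : LPPair ℝ) (φ : SchwartzMap ℝ ℝ)
    (hφ : ∀ ξ : ℝ, 𝓕 (fun x : ℝ => (φ x : ℂ)) ξ ≠ 0 → |ξ| ≤ 1 / 2)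
    (σ : ℝ) {p r : ℝ≥0∞} (hp : 1 ≤ p) (hr : 1 ≤ r) :
    ∃ C, 0 ≤ C ∧ ∀ (n : ℕ) (A B : ℝ),
      besovNormR P σ p r
          (fun x : ℝ => A * (φ x * Real.sin (17 / 12 * 2 ^ n * x)) + B * φ x) ≤
        ENNReal.ofReal (C * (2 ^ (n * σ) * |A| + |B|)) := by
  let ψ : SchwartzMap ℝ ℂ := SchwartzMap.postcompCLM (𝕜 := ℝ) Complex.ofRealCLM φ
  have hψφ (x : ℝ) : ψ x = (φ x : ℂ) := rfl
  obtain ⟨D, hD, hblock⟩ := P.exists_norm_block_le ψ hφ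
  set E := (eLpNorm (fun x : ℝ => (1 + x ^ 2)⁻¹) p volume).toReal
  have hE0 : 0 ≤ E := ENNReal.toReal_nonneg
  have hEtop : eLpNorm (fun x : ℝ => (1 + x ^ 2)⁻¹) p volume = ENNReal.ofReal E :=
    (ENNReal.ofReal_toReal (memLp_inv_one_add_sq hp).eLpNorm_ne_top).symm
  refine ⟨(5 * 2 ^ (4 * |σ|) + 2 ^ (-σ)) * (D * E), by positivity, fun n A B => ?_⟩
  set c : ℤ → ℝ := fun j =>
    (if j ∈ Finset.Icc (n - 4 : ℤ) n then |A| else 0) + if j = -1 then |B| else 0 with hc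
  have hterm (j : ℤ) : ENNReal.ofReal ((2:ℝ) ^ ((j:ℝ) * σ)) * eLpNorm (P.block j
        (fun x : ℝ => ((A * (φ x * Real.sin (17 / 12 * 2 ^ n * x)) + B * φ x : ℝ) : ℂ))) p volume ≤
      (if j ∈ Finset.Icc (n - 4 : ℤ) n then
        ENNReal.ofReal (2 ^ (4 * |σ|) * (2 ^ (n * σ) * |A|) * (D * E)) else 0) +
      (if j = -1 then ENNReal.ofReal (2 ^ (-σ) * |B| * (D * E)) else 0) := by
    have hc0 : 0 ≤ c j := by
      simp only [hc]
      positivity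
    have hbound : eLpNorm (P.block j (fun x : ℝ =>
        ((A * (φ x * Real.sin (17 / 12 * 2 ^ n * x)) + B * φ x : ℝ) : ℂ))) p volume ≤
        ENNReal.ofReal (c j * D * E) := by
      rw [ENNReal.ofReal_mul (by positivity), ← hEtop]
      refine eLpNorm_le_mul_eLpNorm_of_ae_le_mul (.of_forall fun x => ?_) p
      have := hblock n A B j x
      simp only [hψφ] at this
      push_cast at this ⊢
      rw [Real.norm_of_nonneg (by positivity : 0 ≤ (1 + x ^ 2)⁻¹), mul_assoc]
      exact this
    refine (mul_le_mul_right hbound _).trans ?_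
    rw [← ENNReal.ofReal_mul (by positivity)]
    have hif (q : Prop) [Decidable q] (y : ℝ) :
        (if q then ENNReal.ofReal y else 0) = ENNReal.ofReal (if q then y else 0) := by
      split_ifs <;> simp
    rw [hif, hif, ← ENNReal.ofReal_add (by positivity) (by positivity)]
    apply ENNReal.ofReal_le_ofReal
    rw [mul_assoc (c j), ← mul_assoc]
    simp only [hc]
    rw [mul_add, add_mul]
    refine add_le_add ?_ ?_
    · split_ifs with hj
      · rw [Finset.mem_Icc] at hj
        have h1 : |(j : ℝ) - n| ≤ 4 := by
          have h2 : (n : ℝ) - 4 ≤ j := by exact_mod_cast hj.1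
          have h3 : (j : ℝ) ≤ n := by exact_mod_cast hj.2
          rw [abs_le]
          constructor <;> linarith
        have h2 : ((j : ℝ) - n) * σ ≤ 4 * |σ| :=
          (le_abs_self _).trans (by rw [abs_mul]; gcongr)
        have h3 : (2 : ℝ) ^ (j * σ) ≤ 2 ^ (4 * |σ|) * 2 ^ (n * σ) := by
          rw [← Real.rpow_add two_pos]
          exact Real.rpow_le_rpow_of_exponent_le one_le_two (by linarith)
        rw [← mul_assoc (2 ^ (4 * |σ|))]
        gcongr
      · simp
    · split_ifs with hj
      · subst hj
        simp
      · simp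
  refine (lqNorm_le_tsum hr _).trans ((ENNReal.tsum_le_tsum hterm).trans ?_)
  rw [ENNReal.tsum_add, tsum_ite_eq, tsum_eq_sum (s := Finset.Icc (n - 4 : ℤ) n)
    (fun j hj => if_neg hj), Finset.sum_ite_mem, Finset.inter_self, Finset.sum_const, Int.card_Icc,
    show ((n : ℤ) + 1 - (n - 4)).toNat = 5 by omega, nsmul_eq_mul, Nat.cast_ofNat,
    show (5 : ℝ≥0∞) = ENNReal.ofReal 5 by simp, ← ENNReal.ofReal_mul (by norm_num),
    ← ENNReal.ofReal_add (by positivity) (by positivity)]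
  apply ENNReal.ofReal_le_ofReal
  have t1 : (0 : ℝ) ≤ 5 * 2 ^ (4 * |σ|) * |B| * (D * E) := by positivity
  have t2 : (0 : ℝ) ≤ 2 ^ (-σ) * (2 ^ (n * σ) * |A|) * (D * E) := by positivity
  linarith

/-- **Properties of the two families of initial data**
`(ρ_{0,n}, u_{0,n}) = (2ⁿf_n, f_n)` and `(ρ̃_{0,n}, v_{0,n}) = (2ⁿf_n + g_n, f_n + g_n)`,
with `f_n(x) = 2^{-ns}φ(x)sin((17/12)2ⁿx)`, `g_n(x) = 2^{-n/2}φ(x)`: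
(i) they are bounded in `B^{s-1}_{p,r} × B^s_{p,r}` uniformly in `n`;
(ii) their difference is `O(2^{-n/2})`, hence tends to `0` as `n → ∞`. -/
theorem initial_data_properties
    (P : LPPair ℝ) (φ : SchwartzMap ℝ ℝ)
    (hsupp : ∀ ξ : ℝ, 𝓕 (fun x : ℝ => (φ x : ℂ)) ξ ≠ 0 → |ξ| ≤ 1/2)
    (s : ℝ) (p r : ℝ≥0∞) (hp : 1 ≤ p) (hr : 1 ≤ r) :
    (∃ C : ℝ, 0 < C ∧ ∀ n : ℕ,
      (besovNormR P (s-1) p r (fun x : ℝ =>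
          2^(n:ℝ) * (2^(-(n:ℝ)*s) * φ x * Real.sin ((17/12) * 2^n * x))) +
        besovNormR P (s-1) p r (fun x : ℝ =>
          2^(n:ℝ) * (2^(-(n:ℝ)*s) * φ x * Real.sin ((17/12) * 2^n * x)) +
            2^(-(n:ℝ)/2) * φ x) +
        besovNormR P s p r (fun x : ℝ =>
          2^(-(n:ℝ)*s) * φ x * Real.sin ((17/12) * 2^n * x)) +
        besovNormR P s p r (fun x : ℝ =>
          2^(-(n:ℝ)*s) * φ x * Real.sin ((17/12) * 2^n * x) + 2^(-(n:ℝ)/2) * φ x) ≤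
        ENNReal.ofReal C) ∧
      (besovNormR P (s-1) p r (fun x : ℝ =>
          (2^(n:ℝ) * (2^(-(n:ℝ)*s) * φ x * Real.sin ((17/12) * 2^n * x)) +
            2^(-(n:ℝ)/2) * φ x) -
          2^(n:ℝ) * (2^(-(n:ℝ)*s) * φ x * Real.sin ((17/12) * 2^n * x))) +
        besovNormR P s p r (fun x : ℝ =>
          (2^(-(n:ℝ)*s) * φ x * Real.sin ((17/12) * 2^n * x) + 2^(-(n:ℝ)/2) * φ x) -
          2^(-(n:ℝ)*s) * φ x * Real.sin ((17/12) * 2^n * x)) ≤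
        ENNReal.ofReal (C * 2^(-(n:ℝ)/2)))) ∧
    Filter.Tendsto (fun n : ℕ =>
        besovNormR P (s-1) p r (fun x : ℝ =>
          (2^(n:ℝ) * (2^(-(n:ℝ)*s) * φ x * Real.sin ((17/12) * 2^n * x)) +
            2^(-(n:ℝ)/2) * φ x) -
          2^(n:ℝ) * (2^(-(n:ℝ)*s) * φ x * Real.sin ((17/12) * 2^n * x))) +
        besovNormR P s p r (fun x : ℝ =>
          (2^(-(n:ℝ)*s) * φ x * Real.sin ((17/12) * 2^n * x) + 2^(-(n:ℝ)/2) * φ x) -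
          2^(-(n:ℝ)*s) * φ x * Real.sin ((17/12) * 2^n * x)))
      Filter.atTop (nhds 0) := by
  obtain ⟨C₁, hC₁, h₁⟩ := P.exists_besovNormR_le φ hsupp (s - 1) hp hr
  obtain ⟨C₂, hC₂, h₂⟩ := P.exists_besovNormR_le φ hsupp s hp hr
  have hf (n : ℕ) : (2 : ℝ) ^ (n * s) * |(2 : ℝ) ^ (-(n : ℝ) * s)| = 1 := by
    rw [abs_of_pos (by positivity), ← Real.rpow_add two_pos, ← Real.rpow_zero 2]
    congr 1
    ring
  have hf' (n : ℕ) :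
      (2 : ℝ) ^ (n * (s - 1)) * |(2 : ℝ) ^ (n : ℝ) * (2 : ℝ) ^ (-(n : ℝ) * s)| = 1 := by
    rw [abs_of_pos (by positivity), ← Real.rpow_add two_pos, ← Real.rpow_add two_pos,
      ← Real.rpow_zero 2]
    congr 1
    ring
  have hg (n : ℕ) : |(2 : ℝ) ^ (-(n : ℝ) / 2)| = 2 ^ (-(n : ℝ) / 2) := abs_of_pos (by positivity)
  have hg1 (n : ℕ) : (2 : ℝ) ^ (-(n : ℝ) / 2) ≤ 1 :=
    Real.rpow_le_one_of_one_le_of_nonpos one_le_two (by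
      have : (0 : ℝ) ≤ n := n.cast_nonneg
      linarith)
  have hdiff (n : ℕ) : besovNormR P (s-1) p r (fun x : ℝ =>
          (2^(n:ℝ) * (2^(-(n:ℝ)*s) * φ x * Real.sin ((17/12) * 2^n * x)) +
            2^(-(n:ℝ)/2) * φ x) -
          2^(n:ℝ) * (2^(-(n:ℝ)*s) * φ x * Real.sin ((17/12) * 2^n * x))) +
        besovNormR P s p r (fun x : ℝ =>
          (2^(-(n:ℝ)*s) * φ x * Real.sin ((17/12) * 2^n * x) + 2^(-(n:ℝ)/2) * φ x) -
          2^(-(n:ℝ)*s) * φ x * Real.sin ((17/12) * 2^n * x)) ≤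
        ENNReal.ofReal ((3 * (C₁ + C₂) + 1) * 2^(-(n:ℝ)/2)) := by
    have k₁ := h₁ n 0 (2 ^ (-(n : ℝ) / 2))
    have k₂ := h₂ n 0 (2 ^ (-(n : ℝ) / 2))
    simp only [abs_zero, mul_zero, zero_mul, zero_add, hg] at k₁ k₂
    simp only [add_sub_cancel_left]
    refine (add_le_add k₁ k₂).trans ?_
    rw [← ENNReal.ofReal_add (by positivity) (by positivity), ← add_mul]
    exact ENNReal.ofReal_le_ofReal
      (mul_le_mul_of_nonneg_right (by linarith) (by positivity))
  refine ⟨⟨3 * (C₁ + C₂) + 1, by positivity, fun n => ⟨?_, hdiff n⟩⟩, ?_⟩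
  · have k₁ := h₁ n (2 ^ (n : ℝ) * 2 ^ (-(n : ℝ) * s)) 0
    have k₂ := h₁ n (2 ^ (n : ℝ) * 2 ^ (-(n : ℝ) * s)) (2 ^ (-(n : ℝ) / 2))
    have k₃ := h₂ n (2 ^ (-(n : ℝ) * s)) 0
    have k₄ := h₂ n (2 ^ (-(n : ℝ) * s)) (2 ^ (-(n : ℝ) / 2))
    simp only [hf, hf', hg, abs_zero, add_zero, zero_mul, mul_one] at k₁ k₂ k₃ k₄
    simp only [mul_assoc] at k₁ k₂ k₃ k₄ ⊢
    refine (add_le_add (add_le_add (add_le_add k₁ k₂) k₃) k₄).trans ?_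
    rw [← ENNReal.ofReal_add (by positivity) (by positivity),
      ← ENNReal.ofReal_add (by positivity) (by positivity),
      ← ENNReal.ofReal_add (by positivity) (by positivity)]
    apply ENNReal.ofReal_le_ofReal
    have b₁ := mul_le_mul_of_nonneg_left (hg1 n) hC₁
    have b₂ := mul_le_mul_of_nonneg_left (hg1 n) hC₂
    linarith
  · refine tendsto_of_tendsto_of_tendsto_of_le_of_le tendsto_const_nhds ?_ (fun _ => zero_le)
      hdiff
    rw [← ENNReal.ofReal_zero]
    refine ENNReal.tendsto_ofReal ?_
    rw [← mul_zero (3 * (C₁ + C₂) + 1)]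
    refine Tendsto.const_mul _ ?_
    exact (tendsto_rpow_atBot_of_base_gt_one 2 _root_.one_lt_two).comp
      ((tendsto_neg_atTop_atBot.comp tendsto_natCast_atTop_atTop).atBot_div_const two_pos)
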